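/- Let m ∈ ℕ and define the 𝒫_m-valued function E*_{m+2}(τ) = Σ_{r=0}^{m} (1/(r+1)) · binom(m,r) · e_{r,m−r}(τ) · (R_2^r E₂*)(τ). Then for every γ = [[a,b],[c,d]] ∈ SL₂(ℤ) and τ ∈ ℍ, E*_{m+2}(γτ) = (cτ+d)^{m+2} · ρ_m(γ) E*_{m+2}(τ). -/

import Mathlib

open Complex

noncomputable section

/-- The upper half-plane, as a subset of `ℂ`. -/
def UH : Set ℂ := {z : ℂ | 0 < z.im}

/-- Partial derivative in the direction of the real axis, `∂f/∂u`. -/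
noncomputable def du (f : ℂ → ℂ) (z : ℂ) : ℂ := fderiv ℝ f z 1

/-- Partial derivative in the direction of the imaginary axis, `∂f/∂v`. -/
noncomputable def dv (f : ℂ → ℂ) (z : ℂ) : ℂ := fderiv ℝ f z Complex.I

/-- The Wirtinger derivative `∂_τ f = (1/2)(∂f/∂u − i ∂f/∂v)`. -/
noncomputable def dtau (f : ℂ → ℂ) (z : ℂ) : ℂ :=
  (1 / 2) * (du f z - Complex.I * dv f z)

/-- The Wirtinger derivative `∂_τ̄ f = (1/2)(∂f/∂u + i ∂f/∂v)`. -/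
noncomputable def dtauBar (f : ℂ → ℂ) (z : ℂ) : ℂ :=
  (1 / 2) * (du f z + Complex.I * dv f z)

/-- The Maass raising operator `R_k f = 2i ∂_τ f + (k/v) f`. -/
noncomputable def Rop (k : ℤ) (f : ℂ → ℂ) (z : ℂ) : ℂ :=
  2 * Complex.I * dtau f z + ((k : ℂ) / (z.im : ℂ)) * f z

/-- The Maass lowering operator `L_k f = −2i v² ∂_τ̄ f`. -/
noncomputable def Lop (_k : ℤ) (f : ℂ → ℂ) (z : ℂ) : ℂ :=
  -2 * Complex.I * (z.im : ℂ) ^ 2 * dtauBar f z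

/-- The weight-`k` hyperbolic Laplacian
`Δ_k f = −v²(∂²f/∂u² + ∂²f/∂v²) + i k v (∂f/∂u + i ∂f/∂v)`. -/
noncomputable def Lap (k : ℤ) (f : ℂ → ℂ) (z : ℂ) : ℂ :=
  -(z.im : ℂ) ^ 2 * (du (du f) z + dv (dv f) z)
    + Complex.I * (k : ℂ) * (z.im : ℂ) * (du f z + Complex.I * dv f z)

/-- Iterated raising operator `R_k^r = R_{k+2(r−1)} ∘ ⋯ ∘ R_{k+2} ∘ R_k`, `R_k^0 = id`. -/
noncomputable def Riter (k : ℤ) : ℕ → (ℂ → ℂ) → ℂ → ℂ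
  | 0, f => f
  | r + 1, f => Rop (k + 2 * (r : ℤ)) (Riter k r f)

/-- Iterated lowering operator `L_k^r = L_{k−2(r−1)} ∘ ⋯ ∘ L_{k−2} ∘ L_k`, `L_k^0 = id`. -/
noncomputable def Liter (k : ℤ) : ℕ → (ℂ → ℂ) → ℂ → ℂ
  | 0, f => f
  | r + 1, f => Lop (k - 2 * (r : ℤ)) (Liter k r f)

/-- The `𝒫_m`-valued function
`e_{r,m−r}(τ)(X) = ((−1)^{m−r}/r!) v^{r−m} (X−τ)^r (X−conj(τ))^{m−r}`,
as a polynomial in `X`. -/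
noncomputable def epoly (m r : ℕ) (τ : ℂ) : Polynomial ℂ :=
  Polynomial.C ((-1 : ℂ) ^ (m - r) / (r.factorial : ℂ) * (τ.im : ℂ) ^ ((r : ℤ) - (m : ℤ))) *
    (Polynomial.X - Polynomial.C τ) ^ r *
    (Polynomial.X - Polynomial.C ((starRingEnd ℂ) τ)) ^ (m - r)

/-- The representation `ρ_m` of `SL₂` on polynomials of degree ≤ m:
`(ρ_m(γ)p)(X) = (−cX+a)^m p((dX−b)/(−cX+a))`, written polynomially for `deg p ≤ m`. -/
noncomputable def rho (m : ℕ) (a b c d : ℂ) (p : Polynomial ℂ) : Polynomial ℂ :=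
  ∑ j ∈ Finset.range (m + 1), Polynomial.C (p.coeff j) *
    (Polynomial.C d * Polynomial.X - Polynomial.C b) ^ j *
    (-(Polynomial.C c) * Polynomial.X + Polynomial.C a) ^ (m - j)

/-- Möbius action of `SL₂(ℤ)`: `γτ = (aτ+b)/(cτ+d)`. -/
noncomputable def moebZ (g : Matrix.SpecialLinearGroup (Fin 2) ℤ) (z : ℂ) : ℂ :=
  ((g.1 0 0 : ℂ) * z + (g.1 0 1 : ℂ)) / ((g.1 1 0 : ℂ) * z + (g.1 1 1 : ℂ))

/-- The non-holomorphic Eisenstein series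
`E₂*(τ) = 1 − 24 Σ_{n≥1} σ₁(n) e^{2πinτ} − 3/(πv)`. -/
noncomputable def E2star (τ : ℂ) : ℂ :=
  1 - 24 * ∑' n : ℕ, ((∑ d ∈ n.divisors, d : ℕ) : ℂ) *
      Complex.exp (2 * (Real.pi : ℂ) * Complex.I * (n : ℂ) * τ)
    - 3 / ((Real.pi : ℂ) * (τ.im : ℂ))

/-- The `𝒫_m`-valued function
`E*_{m+2}(τ) = Σ_{r=0}^{m} (1/(r+1)) binom(m,r) e_{r,m−r}(τ) (R_2^r E₂*)(τ)`. -/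
noncomputable def Estar (m : ℕ) (τ : ℂ) : Polynomial ℂ :=
  ∑ r ∈ Finset.range (m + 1),
    Polynomial.C ((1 / ((r : ℂ) + 1)) * (m.choose r : ℂ) * Riter 2 r E2star τ) * epoly m r τ

open scoped ContDiff

lemma isOpen_UH : IsOpen UH := isOpen_lt continuous_const Complex.continuous_im

lemma dtau_eq (f : ℂ → ℂ) (z : ℂ) :
    dtau f z = (1 / 2) * (fderiv ℝ f z 1 - Complex.I * fderiv ℝ f z Complex.I) := rfl

lemma dtau_congr {f g : ℂ → ℂ} {z : ℂ} (h : f =ᶠ[nhds z] g) : dtau f z = dtau g z := by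
  rw [dtau_eq, dtau_eq, h.fderiv_eq]

lemma dtau_of_hasDerivAt {f : ℂ → ℂ} {f' z : ℂ} (h : HasDerivAt f f' z) : dtau f z = f' := by
  rw [dtau_eq, (h.hasFDerivAt.restrictScalars ℝ).fderiv]
  simp only [ContinuousLinearMap.coe_restrictScalars', ContinuousLinearMap.toSpanSingleton_apply,
    smul_eq_mul]
  linear_combination (-(1 / 2) * f') * Complex.I_mul_I

lemma dtau_mul {f g : ℂ → ℂ} {z : ℂ} (hf : DifferentiableAt ℝ f z) (hg : DifferentiableAt ℝ g z) :
    dtau (fun w ↦ f w * g w) z = f z * dtau g z + dtau f z * g z := by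
  rw [dtau_eq, dtau_eq, dtau_eq, fderiv_fun_mul hf hg]
  simp only [_root_.add_apply, _root_.smul_apply, smul_eq_mul]
  ring

lemma dtau_comp {f M : ℂ → ℂ} {M' z : ℂ} (hf : DifferentiableAt ℝ f (M z))
    (hM : HasDerivAt M M' z) : dtau (fun w ↦ f (M w)) z = dtau f (M z) * M' := by
  have h := hf.hasFDerivAt.comp z (hM.hasFDerivAt.restrictScalars ℝ)
  rw [dtau_eq, dtau_eq, show (fun w ↦ f (M w)) = f ∘ M from rfl, h.fderiv]
  simp only [ContinuousLinearMap.comp_apply, ContinuousLinearMap.coe_restrictScalars',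
    ContinuousLinearMap.toSpanSingleton_apply, smul_eq_mul, one_mul]
  generalize fderiv ℝ f (M z) = L
  have h1 : L M' = M'.re * L 1 + M'.im * L Complex.I := by
    conv_lhs => rw [show M' = M'.re • (1 : ℂ) + M'.im • Complex.I by
      simp [Complex.re_add_im]]
    rw [map_add, map_smul, map_smul]; simp
  have h2 : L (Complex.I * M') = M'.re * L Complex.I - M'.im * L 1 := by
    conv_lhs => rw [show Complex.I * M' = M'.re • Complex.I - M'.im • (1 : ℂ) by
      apply Complex.ext <;> simp]
    rw [map_sub, map_smul, map_smul]; simp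
  rw [h1, h2]
  conv_rhs => rw [← Complex.re_add_im M']
  linear_combination (1 / 2 * M'.im * L Complex.I) * Complex.I_mul_I

lemma contDiffOn_inv_im : ContDiffOn ℝ ∞ (fun z : ℂ ↦ ((z.im : ℂ))⁻¹) UH := by
  refine ContDiffOn.inv ?_ fun z hz ↦ by exact_mod_cast (ne_of_gt hz)
  exact (Complex.ofRealCLM.contDiff.comp Complex.imCLM.contDiff).contDiffOn

lemma ContDiffOn.dtau_UH {f : ℂ → ℂ} (hf : ContDiffOn ℝ ∞ f UH) : ContDiffOn ℝ ∞ (dtau f) UH := by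
  have h := hf.fderiv_of_isOpen (m := ∞) isOpen_UH (by simp)
  exact contDiffOn_const.mul
    ((h.clm_apply contDiffOn_const).sub (contDiffOn_const.mul (h.clm_apply contDiffOn_const)))

lemma ContDiffOn.rop_UH {f : ℂ → ℂ} (k : ℤ) (hf : ContDiffOn ℝ ∞ f UH) :
    ContDiffOn ℝ ∞ (Rop k f) UH :=
  (contDiffOn_const.mul hf.dtau_UH).add ((contDiffOn_const.mul contDiffOn_inv_im).mul hf)

lemma ContDiffOn.riter_UH {f : ℂ → ℂ} (k : ℤ) (hf : ContDiffOn ℝ ∞ f UH) (r : ℕ) :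
    ContDiffOn ℝ ∞ (Riter k r f) UH := by
  induction r with
  | zero => exact hf
  | succ r ih => exact ih.rop_UH _

section Moebius

variable (γ : Matrix.SpecialLinearGroup (Fin 2) ℤ)

/-- The automorphy factor `cτ + d`. -/
def autFactor (z : ℂ) : ℂ := (γ.1 1 0 : ℂ) * z + (γ.1 1 1 : ℂ)

lemma det_cast : (γ.1 0 0 : ℂ) * γ.1 1 1 - γ.1 0 1 * γ.1 1 0 = 1 := by
  have h := γ.2
  rw [Matrix.det_fin_two] at h
  exact_mod_cast h

lemma autFactor_ne_zero {z : ℂ} (hz : z ∈ UH) : autFactor γ z ≠ 0 :=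
  UpperHalfPlane.denom_ne_zero (γ : Matrix.GeneralLinearGroup (Fin 2) ℝ) ⟨z, hz⟩

lemma coe_smul_eq_moebZ (z : UpperHalfPlane) : ((γ • z : UpperHalfPlane) : ℂ) = moebZ γ z := by
  rw [UpperHalfPlane.coe_specialLinearGroup_apply]
  simp [moebZ]

lemma moebZ_mem_UH {z : ℂ} (hz : z ∈ UH) : moebZ γ z ∈ UH := by
  have h := (γ • (⟨z, hz⟩ : UpperHalfPlane)).im_pos
  rwa [← UpperHalfPlane.coe_im, coe_smul_eq_moebZ] at h

lemma conj_autFactor (z : ℂ) :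
    (starRingEnd ℂ) (autFactor γ z) = autFactor γ ((starRingEnd ℂ) z) := by
  simp [autFactor]

lemma conj_moebZ (z : ℂ) : (starRingEnd ℂ) (moebZ γ z) = moebZ γ ((starRingEnd ℂ) z) := by
  simp [moebZ]

lemma autFactor_conj_ne_zero {z : ℂ} (hz : z ∈ UH) : autFactor γ ((starRingEnd ℂ) z) ≠ 0 := by
  rw [← conj_autFactor]
  simpa using autFactor_ne_zero γ hz

lemma ofReal_im_eq (z : ℂ) : (z.im : ℂ) = (z - (starRingEnd ℂ) z) / (2 * Complex.I) := by
  rw [Complex.sub_conj]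
  field_simp
  push_cast
  ring

lemma moebZ_im {z : ℂ} (hz : z ∈ UH) : ((moebZ γ z).im : ℂ) =
    z.im / (autFactor γ z * autFactor γ ((starRingEnd ℂ) z)) := by
  have h1 := autFactor_ne_zero γ hz
  have h2 := autFactor_conj_ne_zero γ hz
  rw [ofReal_im_eq, ofReal_im_eq z, conj_moebZ]
  have h3 (w : ℂ) : moebZ γ w = (γ.1 0 0 * w + γ.1 0 1) / autFactor γ w := rfl
  rw [h3, h3]
  field_simp
  simp only [autFactor]
  linear_combination (z - (starRingEnd ℂ) z) * det_cast γ

lemma autFactor_sub_conj (z : ℂ) : autFactor γ z - autFactor γ ((starRingEnd ℂ) z) =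
    2 * Complex.I * γ.1 1 0 * z.im := by
  rw [ofReal_im_eq]
  simp only [autFactor]
  field_simp
  ring

lemma hasDerivAt_autFactor (z : ℂ) : HasDerivAt (autFactor γ) (γ.1 1 0) z := by
  exact (((hasDerivAt_id z).const_mul (γ.1 1 0 : ℂ)).add_const (γ.1 1 1 : ℂ)).congr_deriv
    (mul_one _)

lemma hasDerivAt_moebZ {z : ℂ} (hz : z ∈ UH) :
    HasDerivAt (moebZ γ) ((autFactor γ z ^ 2)⁻¹) z := by
  have hn : HasDerivAt (fun w : ℂ ↦ (γ.1 0 0 : ℂ) * w + (γ.1 0 1 : ℂ)) (γ.1 0 0) z := by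
    exact (((hasDerivAt_id z).const_mul (γ.1 0 0 : ℂ)).add_const (γ.1 0 1 : ℂ)).congr_deriv
      (mul_one _)
  refine (hn.div (hasDerivAt_autFactor γ z) (autFactor_ne_zero γ hz)).congr_deriv ?_
  rw [div_eq_mul_inv, mul_eq_right₀ (inv_ne_zero (pow_ne_zero 2 (autFactor_ne_zero γ hz)))]
  simp only [autFactor]
  linear_combination det_cast γ

/-- The raising operator maps functions of weight `k` to functions of weight `k + 2`. -/
lemma rop_moebZ {f : ℂ → ℂ} {k : ℤ} (hf : ContDiffOn ℝ ∞ f UH)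
    (hk : ∀ z ∈ UH, f (moebZ γ z) = autFactor γ z ^ k * f z) :
    ∀ z ∈ UH, Rop k f (moebZ γ z) = autFactor γ z ^ (k + 2) * Rop k f z := by
  intro z hz
  have hd (w : ℂ) (hw : w ∈ UH) : DifferentiableAt ℝ f w :=
    (hf.contDiffAt (isOpen_UH.mem_nhds hw)).differentiableAt (by simp)
  have hj := autFactor_ne_zero γ hz
  have hj' := autFactor_conj_ne_zero γ hz
  have hv : (z.im : ℂ) ≠ 0 := by exact_mod_cast (ne_of_gt hz)
  have hpow := (hasDerivAt_zpow k _ (Or.inl hj)).comp z (hasDerivAt_autFactor γ z)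
  have key : dtau (fun w ↦ f (moebZ γ w)) z = dtau (fun w ↦ autFactor γ w ^ k * f w) z :=
    dtau_congr (Filter.eventuallyEq_of_mem (isOpen_UH.mem_nhds hz) hk)
  rw [dtau_comp (hd _ (moebZ_mem_UH γ hz)) (hasDerivAt_moebZ γ hz),
    dtau_mul (f := fun w ↦ autFactor γ w ^ k) (hpow.differentiableAt.restrictScalars ℝ) (hd z hz),
    dtau_of_hasDerivAt (f := fun w ↦ autFactor γ w ^ k) hpow, zpow_sub_one₀ hj] at key
  have key' : dtau f (moebZ γ z) = autFactor γ z ^ k * (autFactor γ z ^ 2 * dtau f z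
      + k * γ.1 1 0 * autFactor γ z * f z) := by
    field_simp at key
    linear_combination key
  rw [Rop, Rop, key', hk z hz, moebZ_im γ hz, zpow_add₀ hj]
  have h := autFactor_sub_conj γ z
  set j := autFactor γ z
  set j' := autFactor γ ((starRingEnd ℂ) z)
  rw [zpow_ofNat]
  field_simp
  linear_combination (-(k : ℂ) * f z) * h

lemma riter_moebZ {f : ℂ → ℂ} {k : ℤ} (hf : ContDiffOn ℝ ∞ f UH)
    (hk : ∀ z ∈ UH, f (moebZ γ z) = autFactor γ z ^ k * f z) (r : ℕ) :
    ∀ z ∈ UH, Riter k r f (moebZ γ z) = autFactor γ z ^ (k + 2 * (r : ℤ)) * Riter k r f z := by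
  induction r with
  | zero => simpa [Riter] using hk
  | succ r ih =>
    intro z hz
    rw [Riter, rop_moebZ γ (hf.riter_UH k r) ih z hz]
    congr 2
    push_cast
    ring

end Moebius

section E2

lemma E2star_eq (z : UpperHalfPlane) :
    E2star z = EisensteinSeries.E2 z - 3 / (Real.pi * (z.im : ℂ)) := by
  rw [E2star, EisensteinSeries.E2_eq_tsum_cexp, UpperHalfPlane.coe_im]
  congr 3
  rw [← tsum_pnat_eq_tsum_of_eq_zero (f := fun n : ℕ ↦ ((∑ d ∈ n.divisors, d : ℕ) : ℂ) *
    Complex.exp (2 * (Real.pi : ℂ) * Complex.I * (n : ℂ) * z)) (hf := by simp)]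
  refine tsum_congr fun n ↦ ?_
  rw [ArithmeticFunction.sigma_one_apply]
  congr 1
  rw [← Complex.exp_nat_mul]
  congr 1
  ring

lemma contDiffOn_E2star : ContDiffOn ℝ ∞ E2star UH := by
  have h : DifferentiableOn ℂ (EisensteinSeries.E2 ∘ UpperHalfPlane.ofComplex) UH :=
    UpperHalfPlane.mdifferentiable_iff.mp E2_mdifferentiable
  have h2 : ContDiffOn ℝ ∞ (EisensteinSeries.E2 ∘ UpperHalfPlane.ofComplex) UH :=
    (h.contDiffOn isOpen_UH).restrict_scalars ℝ
  refine (h2.sub (contDiffOn_const (c := (3 / Real.pi : ℂ)) |>.mul contDiffOn_inv_im)).congr ?_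
  intro z hz
  have h3 := E2star_eq ⟨z, hz⟩
  rw [← UpperHalfPlane.coe_im] at h3
  rw [h3, Function.comp_apply, UpperHalfPlane.ofComplex_apply_of_im_pos hz, ← div_eq_mul_inv,
    div_div]

lemma E2star_moebZ (γ : Matrix.SpecialLinearGroup (Fin 2) ℤ) :
    ∀ z ∈ UH, E2star (moebZ γ z) = autFactor γ z ^ (2 : ℤ) * E2star z := by
  intro z hz
  have h := congrFun (EisensteinSeries.E2_slash_action γ) ⟨z, hz⟩
  have hj := autFactor_ne_zero γ hz
  have hj' := autFactor_conj_ne_zero γ hz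
  have hv : (z.im : ℂ) ≠ 0 := by exact_mod_cast (ne_of_gt hz)
  have hpi : (Real.pi : ℂ) ≠ 0 := by exact_mod_cast Real.pi_ne_zero
  have him := moebZ_im γ hz
  rw [ModularForm.SL_slash_apply] at h
  have hden : UpperHalfPlane.denom (γ : Matrix.GeneralLinearGroup (Fin 2) ℝ) z
    = autFactor γ z := rfl
  simp only [Pi.sub_apply, Pi.smul_apply, EisensteinSeries.D2, riemannZeta_two, smul_eq_mul, hden]
    at h
  have e1 := E2star_eq ⟨z, hz⟩
  have e2 := E2star_eq (γ • (⟨z, hz⟩ : UpperHalfPlane))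
  rw [← UpperHalfPlane.coe_im, coe_smul_eq_moebZ, him] at e2
  have hs := autFactor_sub_conj γ z
  rw [e2, show E2star z = _ from e1, zpow_ofNat]
  rw [zpow_neg, zpow_ofNat, ← div_eq_mul_inv, div_eq_iff (pow_ne_zero 2 hj)] at h
  rw [h]
  change _ = autFactor γ z ^ 2 * (_ - 3 / (Real.pi * (z.im : ℂ)))
  field_simp
  linear_combination 3 * hs

end E2

lemma rho_eval {m : ℕ} {a b c d x : ℂ} {p : Polynomial ℂ} (hp : p.natDegree ≤ m)
    (hx : -c * x + a ≠ 0) :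
    (rho m a b c d p).eval x = (-c * x + a) ^ m * p.eval ((d * x - b) / (-c * x + a)) := by
  rw [rho, Polynomial.eval_finsetSum, Polynomial.eval_eq_sum_range' (Nat.lt_succ_of_le hp),
    Finset.mul_sum]
  refine Finset.sum_congr rfl fun j hj ↦ ?_
  have hj' : j ≤ m := Nat.lt_succ_iff.mp (Finset.mem_range.mp hj)
  simp only [Polynomial.eval_mul, Polynomial.eval_pow, Polynomial.eval_sub, Polynomial.eval_add,
    Polynomial.eval_neg, Polynomial.eval_C, Polynomial.eval_X]
  obtain ⟨n, rfl⟩ := Nat.exists_eq_add_of_le hj'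
  rw [Nat.add_sub_cancel_left, pow_add, div_pow]
  generalize -c * x + a = s at hx
  field_simp

lemma natDegree_epoly_le {m r : ℕ} (hr : r ≤ m) (τ : ℂ) : (epoly m r τ).natDegree ≤ m := by
  rw [epoly]
  compute_degree
  omega

lemma natDegree_Estar_le (m : ℕ) (τ : ℂ) : (Estar m τ).natDegree ≤ m := by
  refine Polynomial.natDegree_sum_le_of_forall_le _ _ fun r hr ↦ ?_
  exact (Polynomial.natDegree_C_mul_le _ _).trans
    (natDegree_epoly_le (Nat.lt_succ_iff.mp (Finset.mem_range.mp hr)) τ)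

lemma sub_moebZ (γ : Matrix.SpecialLinearGroup (Fin 2) ℤ) {z x : ℂ} (hz : autFactor γ z ≠ 0)
    (hx : -(γ.1 1 0 : ℂ) * x + γ.1 0 0 ≠ 0) :
    x - moebZ γ z = (-(γ.1 1 0 : ℂ) * x + γ.1 0 0) *
      ((γ.1 1 1 * x - γ.1 0 1) / (-(γ.1 1 0 : ℂ) * x + γ.1 0 0) - z) / autFactor γ z := by
  rw [show moebZ γ z = (γ.1 0 0 * z + γ.1 0 1) / autFactor γ z from rfl, mul_sub,
    mul_div_cancel₀ _ hx, eq_div_iff hz, sub_mul, div_mul_cancel₀ _ hz]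
  simp only [autFactor]
  ring

lemma epoly_moebZ_eval (γ : Matrix.SpecialLinearGroup (Fin 2) ℤ) {m r : ℕ} (hr : r ≤ m) {z x : ℂ}
    (hz : z ∈ UH) (hx : -(γ.1 1 0 : ℂ) * x + γ.1 0 0 ≠ 0) :
    autFactor γ z ^ (2 * r) * (epoly m r (moebZ γ z)).eval x =
      autFactor γ z ^ m * ((-(γ.1 1 0 : ℂ) * x + γ.1 0 0) ^ m *
      (epoly m r z).eval ((γ.1 1 1 * x - γ.1 0 1) / (-(γ.1 1 0 : ℂ) * x + γ.1 0 0))) := by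
  have hj := autFactor_ne_zero γ hz
  have hj' := autFactor_conj_ne_zero γ hz
  have hv : (z.im : ℂ) ≠ 0 := by exact_mod_cast (ne_of_gt hz)
  simp only [epoly, Polynomial.eval_mul, Polynomial.eval_pow, Polynomial.eval_sub,
    Polynomial.eval_C, Polynomial.eval_X]
  rw [conj_moebZ, sub_moebZ γ hj hx, sub_moebZ γ hj' hx, moebZ_im γ hz]
  obtain ⟨n, rfl⟩ := Nat.exists_eq_add_of_le hr
  rw [Nat.add_sub_cancel_left, show (r : ℤ) - ((r + n : ℕ) : ℤ) = -(n : ℤ) by push_cast; ring,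
    zpow_neg, zpow_neg, zpow_natCast, zpow_natCast]
  generalize (γ.1 1 1 * x - γ.1 0 1 : ℂ) / (-(γ.1 1 0 : ℂ) * x + γ.1 0 0) = y
  generalize -(γ.1 1 0 : ℂ) * x + γ.1 0 0 = s at *
  simp only [mul_pow, div_pow, pow_add, mul_comm 2 r, pow_mul]
  field_simp

/-- `E*_{m+2}(γτ) = (cτ+d)^{m+2} ρ_m(γ) E*_{m+2}(τ)` for all
`γ ∈ SL₂(ℤ)` and `τ` in the upper half-plane. -/
theorem stmt15 (m : ℕ) (γ : Matrix.SpecialLinearGroup (Fin 2) ℤ) (τ : ℂ) (hτ : τ ∈ UH) :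
    Estar m (moebZ γ τ)
      = Polynomial.C (((γ.1 1 0 : ℂ) * τ + (γ.1 1 1 : ℂ)) ^ (m + 2)) *
          rho m (γ.1 0 0 : ℂ) (γ.1 0 1 : ℂ) (γ.1 1 0 : ℂ) (γ.1 1 1 : ℂ) (Estar m τ) := by
  have hj := autFactor_ne_zero γ hτ
  have hfin : {x : ℂ | -(γ.1 1 0 : ℂ) * x + γ.1 0 0 = 0}.Finite := by
    refine Set.Subsingleton.finite fun x hx y hy ↦ ?_
    rw [Set.mem_ofPred_eq] at hx hy
    have hdet := det_cast γ
    linear_combination (γ.1 1 1 : ℂ) * (x * hy - y * hx) + (γ.1 0 1 : ℂ) * (hx - hy)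
      - (x - y) * hdet
  refine Polynomial.eq_of_infinite_eval_eq _ _ (hfin.infinite_compl.mono fun x hx ↦ ?_)
  have hx' : -(γ.1 1 0 : ℂ) * x + γ.1 0 0 ≠ 0 := hx
  rw [Set.mem_ofPred_eq, Polynomial.eval_mul, rho_eval (natDegree_Estar_le m τ) hx',
    Polynomial.eval_C, Estar, Estar, Polynomial.eval_finsetSum, Polynomial.eval_finsetSum,
    Finset.mul_sum, Finset.mul_sum]
  refine Finset.sum_congr rfl fun r hr ↦ ?_
  have he := epoly_moebZ_eval γ (Nat.lt_succ_iff.mp (Finset.mem_range.mp hr)) hτ hx'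
  rw [Polynomial.eval_mul, Polynomial.eval_mul, Polynomial.eval_C, Polynomial.eval_C,
    riter_moebZ γ contDiffOn_E2star (E2star_moebZ γ) r τ hτ, zpow_add₀ hj,
    show (2 * (r : ℤ)) = ((2 * r : ℕ) : ℤ) by push_cast; ring, zpow_natCast]
  change _ = autFactor γ τ ^ (m + 2) * _
  rw [zpow_ofNat]
  linear_combination ((1 / ((r : ℂ) + 1)) * (m.choose r : ℂ) * Riter 2 r E2star τ *
    autFactor γ τ ^ 2) * he
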